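/- arXiv:1201.2109 — 2 statements merged into one kernel-verified Lean document; each statement's English description precedes it below -/
import Mathlib

section
/- Let u be the simple Parry word associated with the substitution φ, and let R_s = m−1 if α_0 ≥ 2 and R_s = m + ℓ′ − 1 with ℓ′ = min{ℓ ≥ 1 : α_ℓ ≥ 1} if α_0 = 1. Let k, K, n, Q ∈ ℕ satisfy n ≤ F_{k+K}, Q ≤ F_K and u_[n] = φ^k(u_[Q]). Suppose nonempty finite words z_0, …, z_h and z̃_0, …, z̃_h form an abelian co-decomposition of the pair consisting of φ^{K+R_s}(0) and the word obtained from φ^{K+R_s}(0)·u_[Q] by deleting its first Q letters. Then the words φ^k(z_0), …, φ^k(z_h) and φ^k(z̃_0), …, φ^k(z̃_h) form an abelian co-decomposition of the pair consisting of φ^{k+K+R_s}(0) and the word obtained from φ^{k+K+R_s}(0)·u_[n] by deleting its first n letters. -/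
/-- The prefix of length `n` of the infinite word `u`. -/
def pref (u : ℕ → ℕ) (n : ℕ) : List ℕ := (List.range n).map u

/-- `w` is a factor of the infinite word `u`. -/
def IsFactor (u : ℕ → ℕ) (w : List ℕ) : Prop :=
  ∃ i : ℕ, w = (List.range w.length).map (fun j => u (i + j))

/-- The Parikh vector of `w`, viewed as a word over `{0, …, m-1}`. -/
def parikh (m : ℕ) (w : List ℕ) : Fin m → ℤ := fun ℓ => (w.count (ℓ : ℕ) : ℤ)

/-- The set of relative Parikh vectors of factors of `u` of length `n`. -/
def relParikhSet (m : ℕ) (u : ℕ → ℕ) (n : ℕ) : Set (Fin m → ℤ) :=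
  { v | ∃ w : List ℕ, IsFactor u w ∧ w.length = n ∧ v = parikh m w - parikh m (pref u n) }

/-- The extension of a substitution `φ` to finite words. -/
def substW (φ : ℕ → List ℕ) (w : List ℕ) : List ℕ := w.flatMap φ

/-- The `k`-th iterate of the substitution `φ`, applied to the word `w`. -/
def iterW (φ : ℕ → List ℕ) (k : ℕ) (w : List ℕ) : List ℕ := (substW φ)^[k] w

/-- The words `z 0, …, z h` and `zt 0, …, zt h` form an abelian co-decomposition
of the ordered pair `(v, w)`. -/
def IsCoDecomp (m : ℕ) (v w : List ℕ) {h : ℕ} (z zt : Fin (h + 1) → List ℕ) : Prop :=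
  (∀ j, z j ≠ []) ∧ (∀ j, zt j ≠ []) ∧
  (List.ofFn z).flatten = v ∧ (List.ofFn zt).flatten = w ∧
  (∀ j, parikh m (z j) = parikh m (zt j))

theorem length_pref (u : ℕ → ℕ) (n : ℕ) : (pref u n).length = n := by
  simp [pref]

theorem pref_add (u : ℕ → ℕ) (a b : ℕ) :
    pref u (a + b) = pref u a ++ pref (fun i => u (a + i)) b := by
  simp [pref, List.range_add, Function.comp_def]

theorem mem_pref_lt {m : ℕ} {u : ℕ → ℕ} (hu : ∀ i, u i < m) {n x : ℕ} (hx : x ∈ pref u n) :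
    x < m := by
  obtain ⟨i, -, rfl⟩ := List.mem_map.1 hx
  exact hu i

theorem iterW_succ (φ : ℕ → List ℕ) (k : ℕ) (w : List ℕ) :
    iterW φ (k + 1) w = substW φ (iterW φ k w) :=
  Function.iterate_succ_apply' _ _ _

theorem iterW_add (φ : ℕ → List ℕ) (a b : ℕ) (w : List ℕ) :
    iterW φ (a + b) w = iterW φ a (iterW φ b w) :=
  Function.iterate_add_apply _ _ _ _

theorem iterW_append (φ : ℕ → List ℕ) (k : ℕ) (v w : List ℕ) :
    iterW φ k (v ++ w) = iterW φ k v ++ iterW φ k w := by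
  induction k with
  | zero => rfl
  | succ k ih => simp only [iterW_succ, ih, substW, List.flatMap_append]

theorem iterW_nil (φ : ℕ → List ℕ) (k : ℕ) : iterW φ k [] = [] := by
  induction k with
  | zero => rfl
  | succ k ih => simp [iterW_succ, ih, substW]

theorem iterW_flatten (φ : ℕ → List ℕ) (k : ℕ) (L : List (List ℕ)) :
    iterW φ k L.flatten = (L.map (iterW φ k)).flatten := by
  induction L with
  | nil => exact iterW_nil φ k
  | cons w L ih => simp [iterW_append, ih]

theorem flatten_ofFn_iterW (φ : ℕ → List ℕ) (k : ℕ) {h : ℕ} (z : Fin h → List ℕ) :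
    (List.ofFn fun j => iterW φ k (z j)).flatten = iterW φ k (List.ofFn z).flatten := by
  rw [iterW_flatten, List.map_ofFn]
  rfl

theorem iterW_perm (φ : ℕ → List ℕ) (k : ℕ) {v w : List ℕ} (hvw : v.Perm w) :
    (iterW φ k v).Perm (iterW φ k w) := by
  induction k with
  | zero => exact hvw
  | succ k ih => simpa only [iterW_succ, substW] using ih.flatMap_right φ

theorem perm_of_parikh_eq {m : ℕ} {v w : List ℕ} (hv : ∀ x ∈ v, x < m) (hw : ∀ x ∈ w, x < m)
    (hvw : parikh m v = parikh m w) : v.Perm w := by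
  refine List.perm_iff_count.2 fun a => ?_
  by_cases ha : a < m
  · exact Nat.cast_injective (R := ℤ) (congrFun hvw ⟨a, ha⟩)
  · rw [List.count_eq_zero_of_not_mem fun h => ha (hv a h),
      List.count_eq_zero_of_not_mem fun h => ha (hw a h)]

theorem parikh_eq_of_perm (m : ℕ) {v w : List ℕ} (hvw : v.Perm w) : parikh m v = parikh m w :=
  funext fun ℓ => congrArg Nat.cast (hvw.count_eq ℓ)

theorem length_le_length_substW {m : ℕ} {φ : ℕ → List ℕ} (hne : ∀ x < m, φ x ≠ [])
    {w : List ℕ} (hw : ∀ x ∈ w, x < m) : w.length ≤ (substW φ w).length := by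
  induction w with
  | nil => simp
  | cons a w ih =>
    have ha := List.length_pos_iff.2 (hne a (hw a (by simp)))
    have hw' := ih fun x hx => hw x (by simp [hx])
    simp only [substW, List.flatMap_cons, List.length_append, List.length_cons] at hw' ⊢
    omega

theorem mem_iterW_lt {m : ℕ} {φ : ℕ → List ℕ} (hlt : ∀ x < m, ∀ y ∈ φ x, y < m) (k : ℕ)
    {w : List ℕ} (hw : ∀ x ∈ w, x < m) : ∀ x ∈ iterW φ k w, x < m := by
  induction k with
  | zero => exact hw
  | succ k ih =>
    intro x hx
    rw [iterW_succ, substW, List.mem_flatMap] at hx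
    obtain ⟨a, ha, hx⟩ := hx
    exact hlt a (ih a ha) x hx

theorem length_le_length_iterW {m : ℕ} {φ : ℕ → List ℕ} (hne : ∀ x < m, φ x ≠ [])
    (hlt : ∀ x < m, ∀ y ∈ φ x, y < m) (k : ℕ) {w : List ℕ} (hw : ∀ x ∈ w, x < m) :
    w.length ≤ (iterW φ k w).length := by
  induction k with
  | zero => exact le_rfl
  | succ k ih =>
    rw [iterW_succ]
    exact ih.trans (length_le_length_substW hne (mem_iterW_lt hlt k hw))

theorem stmt13
    (m : ℕ) (hm : 2 ≤ m) (α : ℕ → ℕ) (hα0 : 1 ≤ α 0)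
    (hαle : ∀ ℓ, ℓ < m → α ℓ ≤ α 0) (hαlast : 1 ≤ α (m - 1))
    (φ : ℕ → List ℕ)
    (hφ : ∀ ℓ, ℓ + 1 < m → φ ℓ = List.replicate (α ℓ) 0 ++ [ℓ + 1])
    (hφlast : φ (m - 1) = List.replicate (α (m - 1)) 0)
    (u : ℕ → ℕ) (hu : ∀ i, u i < m)
    (hufix : ∀ k : ℕ, iterW φ k [0] = pref u (iterW φ k [0]).length)
    (R : ℕ)
    (hR : R = if 2 ≤ α 0 then m - 1 else m + sInf {ℓ : ℕ | 1 ≤ ℓ ∧ 1 ≤ α ℓ} - 1)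
    (k K n Q : ℕ)
    (hn : n ≤ (iterW φ (k + K) [0]).length) (hQ : Q ≤ (iterW φ K [0]).length)
    (hfact : pref u n = iterW φ k (pref u Q))
    (h : ℕ) (z zt : Fin (h + 1) → List ℕ)
    (hcd : IsCoDecomp m (iterW φ (K + R) [0])
      ((iterW φ (K + R) [0] ++ pref u Q).drop Q) z zt) :
    IsCoDecomp m (iterW φ (k + K + R) [0])
      ((iterW φ (k + K + R) [0] ++ pref u n).drop n)
      (fun j => iterW φ k (z j)) (fun j => iterW φ k (zt j)) := by
  have hlast : ∀ x < m, x + 1 < m ∨ x = m - 1 := fun x hx => by omega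
  have hne : ∀ x < m, φ x ≠ [] := by
    intro x hx
    rcases hlast x hx with hx | rfl
    · simp [hφ x hx]
    · rw [hφlast, Ne, List.replicate_eq_nil_iff]
      omega
  have hlt : ∀ x < m, ∀ y ∈ φ x, y < m := by
    intro x hx y hy
    rcases hlast x hx with hx | rfl
    · rw [hφ x hx, List.mem_append, List.mem_replicate, List.mem_singleton] at hy
      omega
    · rw [hφlast, List.mem_replicate] at hy
      omega
  have hmem : ∀ k, ∀ x ∈ iterW φ k [0], x < m := fun k x hx => by
    rw [hufix k] at hx
    exact mem_pref_lt hu hx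
  obtain ⟨y, hy⟩ : ∃ y, iterW φ (K + R) [0] = pref u Q ++ y := by
    have hle := hQ.trans (length_le_length_iterW hne hlt R (hmem K))
    rw [← iterW_add, add_comm R K] at hle
    obtain ⟨d, hd⟩ := Nat.exists_eq_add_of_le hle
    exact ⟨_, by rw [hufix (K + R), hd, pref_add]⟩
  have hky : iterW φ (k + K + R) [0] = pref u n ++ iterW φ k y := by
    rw [add_assoc, iterW_add, hy, iterW_append, ← hfact]
  have hdrop : ∀ (N : ℕ) (v : List ℕ),
      (pref u N ++ v ++ pref u N).drop N = v ++ pref u N := fun N v => by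
    rw [List.append_assoc, List.drop_left' (length_pref u N)]
  obtain ⟨hz, hzt, hzv, hztw, hpar⟩ := hcd
  have hzlt : ∀ j, ∀ x ∈ z j, x < m := fun j x hx =>
    hmem (K + R) x (hzv ▸ List.mem_flatten_of_mem (List.mem_ofFn.2 ⟨j, rfl⟩) hx)
  have hztlt : ∀ j, ∀ x ∈ zt j, x < m := fun j x hx => by
    have hx := List.mem_flatten_of_mem (List.mem_ofFn.2 ⟨j, rfl⟩) hx
    rw [hztw] at hx
    rcases List.mem_append.1 (List.mem_of_mem_drop hx) with hx | hx
    exacts [hmem _ x hx, mem_pref_lt hu hx]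
  have hiter : ∀ w : List ℕ, w ≠ [] → (∀ x ∈ w, x < m) → iterW φ k w ≠ [] := fun w hw hwm =>
    List.length_pos_iff.1
      ((List.length_pos_iff.2 hw).trans_le (length_le_length_iterW hne hlt k hwm))
  refine ⟨fun j => hiter _ (hz j) (hzlt j), fun j => hiter _ (hzt j) (hztlt j), ?_, ?_,
    fun j => parikh_eq_of_perm m
      (iterW_perm φ k (perm_of_parikh_eq (hzlt j) (hztlt j) (hpar j)))⟩
  · rw [flatten_ofFn_iterW, hzv, ← iterW_add, add_assoc]
  · rw [flatten_ofFn_iterW, hztw, hy, hky, hdrop, hdrop, iterW_append, ← hfact]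
end

section
/- Let t be the Tribonacci word and AC_t its abelian complexity function. Then for each k ∈ {4, 5, 6}, the set { n ∈ ℕ : AC_t(n) = k } is infinite; that is, the abelian complexity of the Tribonacci word attains each of the values 4, 5 and 6 infinitely many times. -/
/-- The Tribonacci substitution: 0 ↦ 01, 1 ↦ 02, 2 ↦ 0. -/
def tribo : ℕ → List ℕ
  | 0 => [0, 1]
  | 1 => [0, 2]
  | _ => [0]

/-- `F k = |φ^k(0)|` for the Tribonacci substitution. -/
def triboF (k : ℕ) : ℕ := (iterW tribo k [0]).length

/-- The abelian complexity of an infinite word: the number of distinct Parikh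
vectors of its factors of length `n`. -/
noncomputable def abelianComplexity (m : ℕ) (u : ℕ → ℕ) (n : ℕ) : ℕ :=
  { v : Fin m → ℤ | ∃ w : List ℕ, IsFactor u w ∧ w.length = n ∧ v = parikh m w }.ncard

/-- `letterCount t a n` is the number of occurrences of `a` among the first `n` letters of `t`. -/
def letterCount (t : ℕ → ℕ) (a : ℕ) : ℕ → ℤ
  | 0 => 0
  | n + 1 => letterCount t a n + if t n = a then 1 else 0

/-- `s j` is the starting position in `t` of the image of the `j`-th letter of `t` under the
Tribonacci substitution. -/
structure IsDesubstitution (t s : ℕ → ℕ) : Prop where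
  zero : s 0 = 0
  succ : ∀ j, s (j + 1) = s j + if t j < 2 then 2 else 1
  fst : ∀ j, t (s j) = 0
  snd : ∀ j, t j < 2 → t (s j + 1) = t j + 1

/-- A Parikh vector, together with the letters at the start of a factor and just after its end. -/
abbrev FactorData : Type := ℤ × ℤ × ℤ × ℕ × ℕ

/-- The positions at which one may cut the image of the letter `a`, with the letter found there. -/
def cuts (a : ℕ) : List (ℤ × ℕ) := if a < 2 then [(0, 0), (1, a + 1)] else [(0, 0)]

/-- The data of the factors cut out of the image of a factor with data `v`, where the first
coordinate is shifted by `e`. -/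
def children (e : ℤ) (v : FactorData) : List FactorData :=
  (cuts v.2.2.2.1).flatMap fun p => (cuts v.2.2.2.2).map fun q =>
    (v.1 + v.2.1 + v.2.2.1 + q.1 - p.1 - e, v.1, v.2.1, p.2, q.2)

/-- The sum of the coordinates of the vector component. -/
def FactorData.sum (v : FactorData) : ℤ := v.1 + v.2.1 + v.2.2.1

/-- All the children of members of `F` whose coordinate sum lies in `[lo, hi]`. -/
def offspring (lo hi e : ℤ) (F : List FactorData) : List FactorData :=
  ((F.flatMap (children e)).filter fun v => decide (lo ≤ v.sum ∧ v.sum ≤ hi)) ∪ []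

/-- The data `v`, relative to the vector `d`, are realized by a pair of positions in `t`. -/
def Realized (t : ℕ → ℕ) (d : ℤ × ℤ × ℤ) (v : FactorData) : Prop :=
  ∃ i i' : ℕ, t i = v.2.2.2.1 ∧ t i' = v.2.2.2.2 ∧
    letterCount t 0 i' = letterCount t 0 i + d.1 + v.1 ∧
    letterCount t 1 i' = letterCount t 1 i + d.2.1 + v.2.1 ∧
    letterCount t 2 i' = letterCount t 2 i + d.2.2 + v.2.2.1

/-- `F` lists the data, relative to `d`, of the pairs of positions in `t` whose difference exceeds
the coordinate sum of `d` by an amount in `[lo, hi]`. -/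
def Describes (t : ℕ → ℕ) (lo hi : ℤ) (d : ℤ × ℤ × ℤ) (F : List FactorData) : Prop :=
  ∀ v : FactorData, v ∈ F ↔ (lo ≤ v.sum ∧ v.sum ≤ hi) ∧ Realized t d v

/-- The factors of extremal length in `F` have images too long or too short for the window. -/
def EdgeCondition (lo hi e : ℤ) (F : List FactorData) : Prop :=
  ∀ v ∈ F, (v.sum = hi → hi < 2 * hi - v.2.2.1 - e) ∧ (v.sum = lo → 2 * lo - v.2.2.1 - e < lo)

instance (lo hi e : ℤ) (F : List FactorData) : Decidable (EdgeCondition lo hi e F) :=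
  inferInstanceAs (Decidable (∀ v ∈ F, _))

/-- The image of a Parikh vector under the Tribonacci substitution, shifted by `e`. -/
def imageVec (e : ℤ) (d : ℤ × ℤ × ℤ) : ℤ × ℤ × ℤ := (d.1 + d.2.1 + d.2.2 + e, d.1, d.2.1)

theorem mem_cuts {a : ℕ} {p : ℤ × ℕ} :
    p ∈ cuts a ↔ p = (0, 0) ∨ (a < 2 ∧ p = (1, a + 1)) := by
  unfold cuts
  split_ifs with h <;> simp [h]

theorem mem_children {e : ℤ} {v w : FactorData} :
    w ∈ children e v ↔ ∃ p ∈ cuts v.2.2.2.1, ∃ q ∈ cuts v.2.2.2.2,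
      w = (v.1 + v.2.1 + v.2.2.1 + q.1 - p.1 - e, v.1, v.2.1, p.2, q.2) := by
  simp only [children, List.mem_flatMap, List.mem_map, eq_comm]

theorem mem_offspring {lo hi e : ℤ} {F : List FactorData} {w : FactorData} :
    w ∈ offspring lo hi e F ↔ (∃ v ∈ F, w ∈ children e v) ∧ lo ≤ w.sum ∧ w.sum ≤ hi := by
  simp only [offspring, List.mem_union_iff, List.not_mem_nil, or_false, List.mem_filter,
    List.mem_flatMap, decide_eq_true_eq]

theorem letterCount_add (t : ℕ → ℕ) (ht : ∀ i, t i < 3) (n : ℕ) :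
    letterCount t 0 n + letterCount t 1 n + letterCount t 2 n = n := by
  induction n with
  | zero => simp [letterCount]
  | succ n ih =>
    have := ht n
    simp only [letterCount]
    push_cast
    split_ifs <;> first | contradiction | omega

namespace IsDesubstitution

variable {t s : ℕ → ℕ}

theorem add_le (h : IsDesubstitution t s) (j k : ℕ) : s j + k ≤ s (j + k) := by
  induction k with
  | zero => simp
  | succ k ih =>
    have := h.succ (j + k)
    rw [← Nat.add_assoc j k 1]
    split_ifs at this <;> omega

theorem exists_eq (h : IsDesubstitution t s) (i : ℕ) :
    ∃ j, i = s j ∨ (t j < 2 ∧ i = s j + 1) := by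
  induction i with
  | zero => exact ⟨0, Or.inl h.zero.symm⟩
  | succ i ih =>
    obtain ⟨j, hj⟩ := ih
    have hs := h.succ j
    by_cases h2 : t j < 2
    · rw [if_pos h2] at hs
      rcases hj with hj | hj
      · exact ⟨j, Or.inr ⟨h2, by omega⟩⟩
      · exact ⟨j + 1, Or.inl (by omega)⟩
    · rw [if_neg h2] at hs
      exact ⟨j + 1, Or.inl (by omega)⟩

/-- Every position lies in the image of some letter, at one of its cuts. -/
theorem exists_cut (h : IsDesubstitution t s) (i : ℕ) :
    ∃ j, ∃ p ∈ cuts (t j), (i : ℤ) = s j + p.1 ∧ t i = p.2 := by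
  obtain ⟨j, rfl | ⟨h2, rfl⟩⟩ := h.exists_eq i
  · exact ⟨j, (0, 0), mem_cuts.2 (Or.inl rfl), by simp, h.fst j⟩
  · exact ⟨j, (1, t j + 1), mem_cuts.2 (Or.inr ⟨h2, rfl⟩), by simp, h.snd j h2⟩

theorem exists_pos (h : IsDesubstitution t s) (j : ℕ) {p : ℤ × ℕ} (hp : p ∈ cuts (t j)) :
    ∃ i : ℕ, (i : ℤ) = s j + p.1 ∧ t i = p.2 := by
  rcases mem_cuts.1 hp with rfl | ⟨h2, rfl⟩
  · exact ⟨s j, by simp, h.fst j⟩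
  · exact ⟨s j + 1, by simp, h.snd j h2⟩

theorem letterCount_image (h : IsDesubstitution t s) (ht : ∀ i, t i < 3) (j : ℕ) :
    letterCount t 0 (s j) = letterCount t 0 j + letterCount t 1 j + letterCount t 2 j ∧
    letterCount t 1 (s j) = letterCount t 0 j ∧ letterCount t 2 (s j) = letterCount t 1 j := by
  induction j with
  | zero => simp [h.zero, letterCount]
  | succ j ih =>
    have h0 := h.fst j
    have h1 := h.snd j
    have h3 := ht j
    rw [h.succ]
    by_cases h2 : t j < 2
    · have h1 := h1 h2
      simp only [if_pos h2, letterCount, h0, h1]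
      refine ⟨?_, ?_, ?_⟩ <;> split_ifs <;> first | contradiction | omega
    · simp only [if_neg h2, letterCount, h0]
      refine ⟨?_, ?_, ?_⟩ <;> split_ifs <;> first | contradiction | omega

theorem letterCount_cut (h : IsDesubstitution t s) (ht : ∀ i, t i < 3) {i j : ℕ} {p : ℤ × ℕ}
    (hp : p ∈ cuts (t j)) (hi : (i : ℤ) = s j + p.1) :
    letterCount t 0 i = letterCount t 0 j + letterCount t 1 j + letterCount t 2 j + p.1 ∧
    letterCount t 1 i = letterCount t 0 j ∧ letterCount t 2 i = letterCount t 1 j := by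
  have hs := h.letterCount_image ht j
  rcases mem_cuts.1 hp with rfl | ⟨h2, rfl⟩
  · obtain rfl : i = s j := by simpa using hi
    simpa using hs
  · obtain rfl : i = s j + 1 := by simp only at hi; omega
    simp [letterCount, h.fst j, hs]

theorem realized_children (h : IsDesubstitution t s) (ht : ∀ i, t i < 3) {d : ℤ × ℤ × ℤ} {e : ℤ}
    {v w : FactorData} (hv : Realized t d v) (hw : w ∈ children e v) :
    Realized t (imageVec e d) w := by
  obtain ⟨j, j', ha, hb, h0, h1, h2⟩ := hv
  obtain ⟨p, hp, q, hq, rfl⟩ := mem_children.1 hw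
  rw [← ha] at hp
  rw [← hb] at hq
  obtain ⟨i, hi, hti⟩ := h.exists_pos j hp
  obtain ⟨i', hi', hti'⟩ := h.exists_pos j' hq
  have c := h.letterCount_cut ht hp hi
  have c' := h.letterCount_cut ht hq hi'
  refine ⟨i, i', hti, hti', ?_, ?_, ?_⟩ <;> simp only [imageVec] <;> omega

/-- The data of `F` determine those of the images. -/
theorem describes_offspring (h : IsDesubstitution t s) (ht : ∀ i, t i < 3) {lo hi e : ℤ}
    {d : ℤ × ℤ × ℤ} {F : List FactorData} (hlh : lo ≤ hi) (hd : 0 ≤ d.1 + d.2.1 + d.2.2 + lo)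
    (hF : Describes t lo hi d F) (hE : EdgeCondition lo hi e F) :
    Describes t lo hi (imageVec e d) (offspring lo hi e F) := by
  intro w
  rw [mem_offspring]
  constructor
  · rintro ⟨⟨v, hv, hw⟩, hs⟩
    exact ⟨hs, h.realized_children ht ((hF v).1 hv).2 hw⟩
  · rintro ⟨hs, i, i', hti, hti', h0, h1, h2⟩
    refine ⟨?_, hs⟩
    obtain ⟨j, p, hp, hpi, hip⟩ := h.exists_cut i
    obtain ⟨j', q, hq, hqi, hiq⟩ := h.exists_cut i'
    have c := h.letterCount_cut ht hp hpi
    have c' := h.letterCount_cut ht hq hqi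
    have hp1 : 0 ≤ p.1 ∧ p.1 ≤ 1 := by
      rcases mem_cuts.1 hp with rfl | ⟨-, rfl⟩ <;> simp
    have hq1 : 0 ≤ q.1 ∧ q.1 ≤ 1 := by
      rcases mem_cuts.1 hq with rfl | ⟨-, rfl⟩ <;> simp
    have hj := letterCount_add t ht j
    have hj' := letterCount_add t ht j'
    have hsj := letterCount_add t ht (s j)
    have hsj' := letterCount_add t ht (s j')
    have hcj := h.letterCount_image ht j
    have hcj' := h.letterCount_image ht j'
    simp only [imageVec] at h0 h1 h2
    simp only [FactorData.sum] at hs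
    have key : ∀ J : ℕ, ∀ δ : ℤ, (J : ℤ) = j + (d.1 + d.2.1 + d.2.2) + δ → lo ≤ δ → δ ≤ hi →
        ∃ v ∈ F, v.sum = δ ∧
          (s J : ℤ) = s j + 2 * (d.1 + d.2.1 + d.2.2 + δ) - d.2.2 - v.2.2.1 := by
      intro J δ hJ hl hh
      have hJ' := letterCount_add t ht J
      have hsJ := letterCount_add t ht (s J)
      have hcJ := h.letterCount_image ht J
      refine ⟨(letterCount t 0 J - letterCount t 0 j - d.1,
        letterCount t 1 J - letterCount t 1 j - d.2.1,
        letterCount t 2 J - letterCount t 2 j - d.2.2, t j, t J), (hF _).2 ⟨?_, j, J, rfl, rfl,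
          ?_, ?_, ?_⟩, ?_, ?_⟩ <;> simp only [FactorData.sum] <;> omega
    refine ⟨(letterCount t 0 j' - letterCount t 0 j - d.1,
        letterCount t 1 j' - letterCount t 1 j - d.2.1,
        letterCount t 2 j' - letterCount t 2 j - d.2.2, t j, t j'), (hF _).2 ⟨⟨?_, ?_⟩, j, j', rfl,
          rfl, ?_, ?_, ?_⟩, mem_children.2 ⟨p, hp, q, hq, ?_⟩⟩
    · by_contra hlt
      simp only [FactorData.sum] at hlt
      obtain ⟨J, hJ⟩ := Int.eq_ofNat_of_zero_le
        (show (0 : ℤ) ≤ j + (d.1 + d.2.1 + d.2.2) + lo by omega)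
      obtain ⟨v, hv, hvs, hsJ⟩ := key J lo hJ.symm le_rfl hlh
      have hE := (hE v hv).2 hvs
      have := h.add_le j' (J - j')
      rw [Nat.add_sub_cancel' (by omega)] at this
      omega
    · by_contra hlt
      simp only [FactorData.sum] at hlt
      obtain ⟨J, hJ⟩ := Int.eq_ofNat_of_zero_le
        (show (0 : ℤ) ≤ j + (d.1 + d.2.1 + d.2.2) + hi by omega)
      obtain ⟨v, hv, hvs, hsJ⟩ := key J hi hJ.symm hlh le_rfl
      have hE := (hE v hv).1 hvs
      have := h.add_le J (j' - J)
      rw [Nat.add_sub_cancel' (by omega)] at this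
      omega
    · simp only; omega
    · simp only; omega
    · simp only; omega
    · obtain ⟨x, y, z, a, b⟩ := w
      simp only [Prod.mk.injEq]
      simp only at h0 h1 h2 hti hti'
      refine ⟨?_, ?_, ?_, ?_, ?_⟩ <;> omega

/-- A realized list that is closed under taking children is complete. -/
theorem describes_of_closed (h : IsDesubstitution t s) (ht : ∀ i, t i < 3) {L : ℤ}
    {F : List FactorData} (hF : ∀ v ∈ F, (0 ≤ v.sum ∧ v.sum ≤ L) ∧ Realized t 0 v)
    (h0 : (0, 0, 0, 0, 0) ∈ F) (hc : ∀ w ∈ offspring 0 L 0 F, w ∈ F) :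
    Describes t 0 L 0 F := by
  have ht0 : t 0 = 0 := by simpa [h.zero] using h.fst 0
  have key : ∀ n i' : ℕ, i' ≤ n → ∀ i : ℕ, i ≤ i' → (i' : ℤ) ≤ i + L →
      (letterCount t 0 i' - letterCount t 0 i, letterCount t 1 i' - letterCount t 1 i,
        letterCount t 2 i' - letterCount t 2 i, t i, t i') ∈ F := by
    intro n
    induction n with
    | zero =>
      intro i' hi' i hi _
      obtain rfl : i' = 0 := by omega
      obtain rfl : i = 0 := by omega
      simpa [ht0] using h0
    | succ n ih =>
      intro i' hi' i hi hiL
      obtain ⟨j, p, hp, hpi, hip⟩ := h.exists_cut i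
      obtain ⟨j', q, hq, hqi, hiq⟩ := h.exists_cut i'
      have c := h.letterCount_cut ht hp hpi
      have c' := h.letterCount_cut ht hq hqi
      have hp1 : p.1 = 0 ∨ (p.1 = 1 ∧ s (j + 1) = s j + 2) := by
        have := h.succ j
        rcases mem_cuts.1 hp with rfl | ⟨h2, rfl⟩
        · simp
        · rw [if_pos h2] at this
          simp [this]
      have hq1 : q.1 = 0 ∨ (q.1 = 1 ∧ s (j' + 1) = s j' + 2) := by
        have := h.succ j'
        rcases mem_cuts.1 hq with rfl | ⟨h2, rfl⟩
        · simp
        · rw [if_pos h2] at this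
          simp [this]
      have hjj : j ≤ j' := by
        by_contra hlt
        have h1 := h.add_le (j' + 1) (j - (j' + 1))
        rw [Nat.add_sub_cancel' (by omega)] at h1
        have h2 := h.add_le j' 1
        omega
      have hjL : (j' : ℤ) ≤ j + L := by
        rcases hjj.eq_or_lt with rfl | hlt
        · omega
        · have h1 := h.add_le (j + 1) (j' - (j + 1))
          rw [Nat.add_sub_cancel' (by omega)] at h1
          have h2 := h.add_le j 1
          omega
      have hj'n : j' ≤ n := by
        rcases Nat.eq_zero_or_pos j' with rfl | hpos
        · omega
        · have h1 := h.add_le 1 (j' - 1)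
          rw [Nat.add_sub_cancel' (by omega)] at h1
          have h2 := h.succ 0
          simp only [ht0, h.zero] at h2
          norm_num at h2
          omega
      have hmem := ih j' hj'n j hjj hjL
      refine hc _ (mem_offspring.2 ⟨⟨_, hmem, mem_children.2 ⟨p, hp, q, hq, ?_⟩⟩, ?_⟩)
      · simp only [Prod.mk.injEq]
        refine ⟨?_, ?_, ?_, ?_, ?_⟩ <;> omega
      · have := letterCount_add t ht i
        have := letterCount_add t ht i'
        simp only [FactorData.sum]
        omega
  intro v
  refine ⟨hF v, ?_⟩
  rintro ⟨hs, i, i', hi, hi', h0, h1, h2⟩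
  have hl := letterCount_add t ht i
  have hl' := letterCount_add t ht i'
  simp only [FactorData.sum] at hs
  simp only [Prod.fst_zero, Prod.snd_zero] at h0 h1 h2
  convert key i' i' le_rfl i (by omega) (by omega) using 1
  obtain ⟨x, y, z, a, b⟩ := v
  simp only [Prod.mk.injEq]
  simp only at h0 h1 h2 hi hi'
  refine ⟨?_, ?_, ?_, ?_, ?_⟩ <;> omega

end IsDesubstitution

/-- The data in `F` together with their children of coordinate sum in `[0, L]`. -/
def withOffspring (L : ℤ) (F : List FactorData) : List FactorData :=
  offspring 0 L 0 F ∪ F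

/-- Data of factors of length at most `L`, obtained by eight rounds of taking children. -/
def shortFactorData (L : ℤ) : List FactorData :=
  (withOffspring L)^[8] [(0, 0, 0, 0, 0)]

theorem describes_shortFactorData {t s : ℕ → ℕ} (h : IsDesubstitution t s) (ht : ∀ i, t i < 3)
    {L : ℤ} (hL : 0 ≤ L) (h0 : (0, 0, 0, 0, 0) ∈ shortFactorData L)
    (hc : ∀ w ∈ offspring 0 L 0 (shortFactorData L), w ∈ shortFactorData L) :
    Describes t 0 L 0 (shortFactorData L) := by
  refine h.describes_of_closed ht ?_ h0 hc
  unfold shortFactorData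
  generalize 8 = n
  induction n with
  | zero =>
    intro v hv
    obtain rfl : v = (0, 0, 0, 0, 0) := by simpa using hv
    have ht0 : t 0 = 0 := by simpa [h.zero] using h.fst 0
    exact ⟨by simpa [FactorData.sum] using hL, 0, 0, by simp [ht0]⟩
  | succ n ih =>
    intro v hv
    rw [Function.iterate_succ_apply', withOffspring, List.mem_union_iff, mem_offspring] at hv
    rcases hv with ⟨⟨u, hu, hv⟩, hs⟩ | hv
    · exact ⟨hs, h.realized_children ht (ih u hu).2 hv⟩
    · exact ih v hv

/-- The data in `F` relative to `d`, with coordinate sum in `[lo, hi]`. -/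
def recenter (lo hi : ℤ) (d : ℤ × ℤ × ℤ) (F : List FactorData) : List FactorData :=
  (F.map fun v => (v.1 - d.1, v.2.1 - d.2.1, v.2.2.1 - d.2.2, v.2.2.2)).filter
    fun v => decide (lo ≤ v.sum ∧ v.sum ≤ hi)

theorem Describes.recenter {t : ℕ → ℕ} {lo hi L : ℤ} {d : ℤ × ℤ × ℤ} {F : List FactorData}
    (hF : Describes t 0 L 0 F) (hlo : 0 ≤ d.1 + d.2.1 + d.2.2 + lo)
    (hhi : d.1 + d.2.1 + d.2.2 + hi ≤ L) : Describes t lo hi d (recenter lo hi d F) := by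
  intro v
  simp only [_root_.recenter, List.mem_filter, List.mem_map, decide_eq_true_eq, hF _]
  constructor
  · rintro ⟨⟨u, ⟨-, i, i', hi, hi', h0, h1, h2⟩, rfl⟩, hs⟩
    refine ⟨hs, i, i', hi, hi', ?_, ?_, ?_⟩ <;> simp_all
  · rintro ⟨hs, i, i', hi, hi', h0, h1, h2⟩
    refine ⟨⟨(v.1 + d.1, v.2.1 + d.2.1, v.2.2.1 + d.2.2, v.2.2.2), ⟨?_, i, i', hi, hi', ?_, ?_, ?_⟩,
      by simp⟩, hs⟩
    · simp only [FactorData.sum] at hs ⊢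
      omega
    all_goals simp only [Prod.fst_zero, Prod.snd_zero]; omega

theorem letterCount_add_count (t : ℕ → ℕ) (a i n : ℕ) :
    letterCount t a (i + n) =
      letterCount t a i + (((List.range n).map fun j => t (i + j)).count a : ℤ) := by
  induction n with
  | zero => simp
  | succ n ih =>
    rw [← add_assoc, letterCount, ih, List.range_succ, List.map_append, List.count_append]
    simp only [List.map_cons, List.map_nil, List.count_singleton, beq_iff_eq]
    push_cast
    ring

/-- The distinct vectors in `F` with coordinate sum `δ`. -/
def vectorsOfSum (δ : ℤ) (F : List FactorData) : List (ℤ × ℤ × ℤ) :=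
  ((F.filter fun v => decide (v.sum = δ)).map fun v => (v.1, v.2.1, v.2.2.1)).dedup

theorem Describes.abelianComplexity_eq {t : ℕ → ℕ} (ht : ∀ i, t i < 3) {lo hi δ : ℤ}
    {d : ℤ × ℤ × ℤ} {F : List FactorData} (hF : Describes t lo hi d F) (hlo : lo ≤ δ)
    (hhi : δ ≤ hi) {n : ℕ} (hn : (n : ℤ) = d.1 + d.2.1 + d.2.2 + δ) :
    abelianComplexity 3 t n = (vectorsOfSum δ F).length := by
  let f : ℤ × ℤ × ℤ → Fin 3 → ℤ := fun x => ![d.1 + x.1, d.2.1 + x.2.1, d.2.2 + x.2.2]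
  have hf : Function.Injective f := by
    intro x y hxy
    have h0 := congrFun hxy 0
    have h1 := congrFun hxy 1
    have h2 := congrFun hxy 2
    simp only [f, Matrix.cons_val] at h0 h1 h2
    exact Prod.ext (by omega) (Prod.ext (by omega) (by omega))
  have hset : { v : Fin 3 → ℤ | ∃ w : List ℕ, IsFactor t w ∧ w.length = n ∧ v = parikh 3 w } =
      f '' ((vectorsOfSum δ F).toFinset : Set (ℤ × ℤ × ℤ)) := by
    ext v
    simp only [Set.mem_ofPred_eq, Set.mem_image, List.coe_toFinset, vectorsOfSum, List.mem_dedup,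
      List.mem_map, List.mem_filter, decide_eq_true_eq, hF _]
    constructor
    · rintro ⟨w, ⟨i, hw⟩, hwn, rfl⟩
      rw [hwn] at hw
      have c0 := letterCount_add_count t 0 i n
      have c1 := letterCount_add_count t 1 i n
      have c2 := letterCount_add_count t 2 i n
      rw [← hw] at c0 c1 c2
      have hl := letterCount_add t ht i
      have hl' := letterCount_add t ht (i + n)
      push_cast at hl'
      refine ⟨(w.count 0 - d.1, w.count 1 - d.2.1, w.count 2 - d.2.2),
        ⟨(w.count 0 - d.1, w.count 1 - d.2.1, w.count 2 - d.2.2, t i, t (i + n)),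
          ⟨⟨?_, i, i + n, rfl, rfl, ?_, ?_, ?_⟩, ?_⟩, rfl⟩, ?_⟩
      · simp only [FactorData.sum]; omega
      · simp only; omega
      · simp only; omega
      · simp only; omega
      · simp only [FactorData.sum]; omega
      · ext ℓ
        fin_cases ℓ <;> simp [f, parikh]
    · rintro ⟨x, ⟨u, ⟨⟨-, i, i', -, -, h0, h1, h2⟩, hs⟩, rfl⟩, rfl⟩
      have hl := letterCount_add t ht i
      have hl' := letterCount_add t ht i'
      simp only [FactorData.sum] at hs
      obtain rfl : i' = i + n := by omega
      refine ⟨(List.range n).map fun j => t (i + j), ⟨i, by simp⟩, by simp, ?_⟩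
      have c0 := letterCount_add_count t 0 i n
      have c1 := letterCount_add_count t 1 i n
      have c2 := letterCount_add_count t 2 i n
      ext ℓ
      fin_cases ℓ <;> simp [f, parikh] <;> omega
  rw [abelianComplexity, hset, Set.ncard_image_of_injective _ hf, Set.ncard_coe_finset,
    List.card_toFinset, vectorsOfSum, List.dedup_idem]

theorem pref_succ (t : ℕ → ℕ) (n : ℕ) : pref t (n + 1) = pref t n ++ [t n] := by
  simp [pref, List.range_succ]

theorem substW_tribo_length {w : List ℕ} (hw : 0 ∈ w) : w.length < (substW tribo w).length := by
  induction w with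
  | nil => simp at hw
  | cons a w ih =>
    have hle : ∀ u : List ℕ, u.length ≤ (substW tribo u).length := by
      intro u
      induction u with
      | nil => simp
      | cons b u ihu =>
        have : 1 ≤ (tribo b).length := by rcases b with _ | _ | b <;> simp [tribo]
        simp only [substW, List.flatMap_cons, List.length_append, List.length_cons] at ihu ⊢
        omega
    rcases List.mem_cons.1 hw with rfl | hw
    · have := hle w
      simp only [substW, List.flatMap_cons, List.length_append, List.length_cons, tribo,
        List.length_nil] at this ⊢
      omega
    · have := ih hw
      have : 1 ≤ (tribo a).length := by rcases a with _ | _ | a <;> simp [tribo]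
      simp only [substW, List.flatMap_cons, List.length_append, List.length_cons] at *
      omega

theorem lt_length_iterW_tribo (k : ℕ) :
    0 ∈ iterW tribo k [0] ∧ k < (iterW tribo k [0]).length := by
  induction k with
  | zero => simp [iterW]
  | succ k ih =>
    have he : iterW tribo (k + 1) [0] = substW tribo (iterW tribo k [0]) :=
      Function.iterate_succ_apply' _ _ _
    rw [he]
    refine ⟨List.mem_flatMap.2 ⟨0, ih.1, by simp [tribo]⟩, ?_⟩
    have := substW_tribo_length ih.1
    omega

theorem exists_isDesubstitution (t : ℕ → ℕ)
    (htfix : ∀ k : ℕ, iterW tribo k [0] = pref t (iterW tribo k [0]).length) :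
    ∃ s, IsDesubstitution t s := by
  have hprefix : ∀ {m n : ℕ}, m ≤ n → pref t m <+: pref t n := by
    intro m n hmn
    obtain ⟨r, rfl⟩ := Nat.exists_eq_add_of_le hmn
    rw [pref, pref, List.range_add, List.map_append]
    exact List.prefix_append _ _
  have hsub : ∀ j, substW tribo (pref t j) = pref t (substW tribo (pref t j)).length := by
    intro j
    obtain ⟨r, hr⟩ := hprefix (lt_length_iterW_tribo j).2.le
    have h2 := htfix (j + 1)
    have he : iterW tribo (j + 1) [0] = substW tribo (iterW tribo j [0]) :=
      Function.iterate_succ_apply' _ _ _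
    have h1 : substW tribo (pref t j) <+: pref t (iterW tribo (j + 1) [0]).length := by
      rw [← h2, he, htfix j, ← hr, substW, substW, List.flatMap_append]
      exact List.prefix_append _ _
    refine (List.prefix_of_prefix_length_le h1 (hprefix ?_) (by simp [pref])).eq_of_length
      (by simp [pref])
    simpa [pref] using h1.length_le
  have hstep : ∀ j, pref t ((substW tribo (pref t j)).length + (tribo (t j)).length) =
      pref t (substW tribo (pref t j)).length ++ tribo (t j) := by
    intro j
    have := hsub (j + 1)
    rw [pref_succ, substW, List.flatMap_append, ← substW, List.length_append,
      List.flatMap_singleton] at this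
    rw [← this, ← hsub j]
  have hlen : ∀ a, (tribo a).length = if a < 2 then 2 else 1 := by
    rintro (_ | _ | a) <;> simp [tribo]
  have hget : ∀ j m (hm : m < (tribo (t j)).length),
      t ((substW tribo (pref t j)).length + m) = (tribo (t j))[m] := by
    intro j m hm
    have h1 := congrArg (fun l => l[(substW tribo (pref t j)).length + m]?) (hstep j)
    rw [List.getElem?_append_right (by simp [pref])] at h1
    simpa [pref, hm] using h1
  refine ⟨fun j => (substW tribo (pref t j)).length, by simp [pref, substW], fun j => ?_,
    fun j => ?_, fun j hj => ?_⟩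
  · rw [← hlen, pref_succ, substW, List.flatMap_append, List.length_append,
      List.flatMap_singleton, substW]
  · have := hget j 0 (by rw [hlen]; split_ifs <;> omega)
    rw [Nat.add_zero] at this
    rw [this]
    rcases t j with _ | _ | a <;> simp [tribo]
  · have := hget j 1 (by rw [hlen, if_pos hj]; omega)
    rw [this]
    interval_cases t j <;> simp [tribo]

theorem Describes.congr {t : ℕ → ℕ} {lo hi : ℤ} {d : ℤ × ℤ × ℤ} {F G : List FactorData}
    (hF : Describes t lo hi d F) (h : ∀ v ∈ F, v ∈ G) (h' : ∀ v ∈ G, v ∈ F) :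
    Describes t lo hi d G :=
  fun v => ⟨fun hv => (hF v).1 (h' v hv), fun hv => h v ((hF v).2 hv)⟩

/-- The offspring after three steps with shifts `1, 0, 0`, in the window `[-2, 3]`. -/
def tripleOffspring (F : List FactorData) : List FactorData :=
  offspring (-2) 3 0 (offspring (-2) 3 0 (offspring (-2) 3 1 F))

/-- The image of a vector after three steps with shifts `1, 0, 0`. -/
def tripleImage (d : ℤ × ℤ × ℤ) : ℤ × ℤ × ℤ := imageVec 0 (imageVec 0 (imageVec 1 d))

/-- The edge conditions for the three steps of `tripleOffspring`. -/
abbrev TripleEdgeCondition (F : List FactorData) : Prop :=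
  EdgeCondition (-2) 3 1 F ∧ EdgeCondition (-2) 3 0 (offspring (-2) 3 1 F) ∧
    EdgeCondition (-2) 3 0 (offspring (-2) 3 0 (offspring (-2) 3 1 F))

/-- Vectors with nonnegative coordinates, the first being at least `2`. -/
def IsLarge (d : ℤ × ℤ × ℤ) : Prop := 2 ≤ d.1 ∧ 0 ≤ d.2.1 ∧ 0 ≤ d.2.2

theorem IsLarge.tripleImage {d : ℤ × ℤ × ℤ} (hd : IsLarge d) : IsLarge (tripleImage d) := by
  obtain ⟨h0, h1, h2⟩ := hd
  refine ⟨?_, ?_, ?_⟩ <;> simp only [_root_.tripleImage, imageVec] <;> omega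

theorem IsLarge.sum_lt_tripleImage {d : ℤ × ℤ × ℤ} (hd : IsLarge d) :
    d.1 + d.2.1 + d.2.2 <
      (_root_.tripleImage d).1 + (_root_.tripleImage d).2.1 + (_root_.tripleImage d).2.2 := by
  obtain ⟨h0, h1, h2⟩ := hd
  simp only [_root_.tripleImage, imageVec]
  omega

theorem Describes.triple {t s : ℕ → ℕ} (h : IsDesubstitution t s) (ht : ∀ i, t i < 3)
    {d : ℤ × ℤ × ℤ} {F : List FactorData} (hF : Describes t (-2) 3 d F) (hd : IsLarge d)
    (hE : TripleEdgeCondition F) : Describes t (-2) 3 (tripleImage d) (tripleOffspring F) := by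
  obtain ⟨h0, h1, h2⟩ := hd
  refine h.describes_offspring ht (by norm_num) ?_ (h.describes_offspring ht (by norm_num) ?_
    (h.describes_offspring ht (by norm_num) ?_ hF hE.1) hE.2.1) hE.2.2 <;>
  first | omega | (simp only [imageVec]; omega)

/-- The data of the factors of length between `6` and `11`, relative to `(4, 3, 1)`. -/
def initialData : List FactorData := recenter (-2) 3 (4, 3, 1) (shortFactorData 11)

/-- A list of data that is invariant, as a set, under `tripleOffspring`. -/
def stableData : List FactorData := tripleOffspring (tripleOffspring initialData)

theorem shortFactorData_closed : (0, 0, 0, 0, 0) ∈ shortFactorData 11 ∧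
    ∀ w ∈ offspring 0 11 0 (shortFactorData 11), w ∈ shortFactorData 11 := by decide +kernel

theorem stableData_spec :
    TripleEdgeCondition initialData ∧ TripleEdgeCondition (tripleOffspring initialData) ∧
    TripleEdgeCondition stableData ∧
    (∀ v ∈ tripleOffspring stableData, v ∈ stableData) ∧
    (∀ v ∈ stableData, v ∈ tripleOffspring stableData) ∧
    (vectorsOfSum (-2) stableData).length = 4 ∧ (vectorsOfSum 1 stableData).length = 5 ∧
    (vectorsOfSum 3 stableData).length = 6 := by decide +kernel

theorem isLarge_iterate_tripleImage (m : ℕ) : IsLarge (tripleImage^[m] (4, 3, 1)) := by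
  induction m with
  | zero => exact ⟨by norm_num, by norm_num, by norm_num⟩
  | succ m ih =>
    rw [Function.iterate_succ_apply']
    exact ih.tripleImage

theorem describes_stableData {t s : ℕ → ℕ} (h : IsDesubstitution t s) (ht : ∀ i, t i < 3)
    (m : ℕ) : Describes t (-2) 3 (tripleImage^[m + 2] (4, 3, 1)) stableData := by
  obtain ⟨hE0, hE1, hE, hsub, hsup, -⟩ := stableData_spec
  induction m with
  | zero =>
    have h0 : Describes t (-2) 3 (4, 3, 1) initialData :=
      (describes_shortFactorData h ht (by norm_num) shortFactorData_closed.1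
        shortFactorData_closed.2).recenter (by norm_num) (by norm_num)
    have h1 := h0.triple h ht (isLarge_iterate_tripleImage 0) hE0
    exact h1.triple h ht (isLarge_iterate_tripleImage 1) hE1
  | succ m ih =>
    rw [Nat.add_right_comm, Function.iterate_succ_apply']
    exact (ih.triple h ht (isLarge_iterate_tripleImage _) hE).congr hsub hsup

theorem infinite_abelianComplexity_eq {t s : ℕ → ℕ} (h : IsDesubstitution t s)
    (ht : ∀ i, t i < 3) {δ : ℤ} (hlo : -2 ≤ δ) (hhi : δ ≤ 3) :
    { n : ℕ | abelianComplexity 3 t n = (vectorsOfSum δ stableData).length }.Infinite := by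
  let d : ℕ → ℤ × ℤ × ℤ := fun m => tripleImage^[m + 2] (4, 3, 1)
  let f : ℕ → ℕ := fun m => ((d m).1 + (d m).2.1 + (d m).2.2 + δ).toNat
  have hf : ∀ m, (f m : ℤ) = (d m).1 + (d m).2.1 + (d m).2.2 + δ := by
    intro m
    obtain ⟨h0, h1, h2⟩ : IsLarge (d m) := isLarge_iterate_tripleImage _
    exact Int.toNat_of_nonneg (by omega)
  have hmono : StrictMono f := strictMono_nat_of_lt_succ fun m => by
    have hlt := (isLarge_iterate_tripleImage (m + 2)).sum_lt_tripleImage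
    rw [← Function.iterate_succ_apply' tripleImage, Nat.succ_eq_add_one, Nat.add_right_comm] at hlt
    have h1 := hf m
    have h2 := hf (m + 1)
    simp only [d] at h1 h2
    omega
  exact Set.infinite_of_injective_forall_mem hmono.injective fun m =>
    (describes_stableData h ht m).abelianComplexity_eq ht hlo hhi (hf m)

theorem stmt18 (t : ℕ → ℕ) (ht : ∀ i, t i < 3)
    (htfix : ∀ k : ℕ, iterW tribo k [0] = pref t (iterW tribo k [0]).length) :
    ∀ k ∈ ({4, 5, 6} : Set ℕ),
      { n : ℕ | abelianComplexity 3 t n = k }.Infinite := by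
  obtain ⟨s, h⟩ := exists_isDesubstitution t htfix
  obtain ⟨-, -, -, -, -, h4, h5, h6⟩ := stableData_spec
  rintro k (rfl | rfl | rfl)
  · exact h4 ▸ infinite_abelianComplexity_eq h ht (by norm_num) (by norm_num)
  · exact h5 ▸ infinite_abelianComplexity_eq h ht (by norm_num) (by norm_num)
  · exact h6 ▸ infinite_abelianComplexity_eq h ht (by norm_num) (by norm_num)
end
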